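/- Let s₀ > 7/2. There exists C > 0 such that for all u, w ∈ H^{s₀+1}(𝕋): |⟨u H∂_x⁴u, (Jw)²⟩ + ⟨u² Jw, HJ∂_x⁴w⟩ − 4⟨u∂_x u · H∂_x w, w⟩| ≤ C‖u‖_{H^{s₀}}²‖w‖_{L²}², where H is the Hilbert transform, J the multiplier ψ(ξ)/|ξ|, and ⟨·,·⟩ the L² inner product. -/

import Mathlib

open MeasureTheory Real Complex AddCircle
open scoped BigOperators ENNReal

noncomputable section

instance : Fact (0 < 2 * Real.pi) := ⟨by positivity⟩

/-- The torus `ℝ/2πℤ`. -/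
abbrev Torus := AddCircle (2 * Real.pi)

/-- Fourier coefficient of a real-valued function on the torus
(with respect to the normalized Haar measure). -/
def FC (f : Torus → ℝ) (n : ℤ) : ℂ :=
  fourierCoeff (fun x => (f x : ℂ)) n

/-- Inhomogeneous Sobolev `H^s` norm, via Fourier coefficients:
`‖f‖_{H^s} = ( ∑ ⟨n⟩^{2s} |f̂(n)|² )^{1/2}`. -/
def HsNorm (s : ℝ) (f : Torus → ℝ) : ℝ :=
  Real.sqrt (∑' n : ℤ, ((1 + (n : ℝ) ^ 2) ^ s) * ‖FC f n‖ ^ 2)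

/-- Homogeneous Sobolev norm `‖D^s f‖_{L²} = ( ∑ |n|^{2s} |f̂(n)|² )^{1/2}`,
where `D = 𝓕⁻¹ |ξ| 𝓕`. -/
def DsNorm (s : ℝ) (f : Torus → ℝ) : ℝ :=
  Real.sqrt (∑' n : ℤ, (|(n : ℝ)| ^ (2 * s)) * ‖FC f n‖ ^ 2)

/-- Membership in `H^s(𝕋)` (finiteness of the Sobolev sum). -/
def MemHs (s : ℝ) (f : Torus → ℝ) : Prop :=
  Summable (fun n : ℤ => ((1 + (n : ℝ) ^ 2) ^ s) * ‖FC f n‖ ^ 2)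

/-- `g` is the image of `f` under the Fourier multiplier with symbol `m`. -/
def HasSymbol (m : ℤ → ℂ) (f g : Torus → ℝ) : Prop :=
  ∀ n : ℤ, FC g n = m n * FC f n

/-- Symbol of the Hilbert transform `H`: `-i sgn(n)`. -/
def symH (n : ℤ) : ℂ := -Complex.I * (Int.sign n : ℂ)

/-- Symbol of `D^s = 𝓕⁻¹|ξ|^s𝓕`. -/
def symD (s : ℝ) (n : ℤ) : ℂ := ((|(n : ℝ)| ^ s : ℝ) : ℂ)

/-- Symbol of `∂ₓ`. -/
def symDx (n : ℤ) : ℂ := Complex.I * (n : ℂ)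

/-- Symbol of the smoothed antiderivative `J`: `ψ(ξ)/|ξ|`. -/
def symJ (ψ : ℝ → ℝ) (n : ℤ) : ℂ := ((ψ n / |(n : ℝ)| : ℝ) : ℂ)

/-- `ψ` is a smooth cutoff: `0 ≤ ψ ≤ 1`, `ψ = 1` on `|ξ| ≥ 2`, `ψ = 0` on `|ξ| ≤ 1`. -/
def IsCutoff (ψ : ℝ → ℝ) : Prop :=
  ContDiff ℝ (⊤ : ℕ∞) ψ ∧ (∀ x, 0 ≤ ψ x) ∧ (∀ x, ψ x ≤ 1) ∧
    (∀ x, 2 ≤ |x| → ψ x = 1) ∧ (∀ x, |x| ≤ 1 → ψ x = 0)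

/-- Rapid decay of Fourier coefficients (a model for "sufficiently smooth"). -/
def SmoothFC (f : Torus → ℝ) : Prop :=
  ∀ k : ℕ, Summable (fun n : ℤ => |(n : ℝ)| ^ k * ‖FC f n‖)

/-- `L²` pairing `⟨f, g⟩ = ∫ f g`. -/
def inn (f g : Torus → ℝ) : ℝ := ∫ x : Torus, f x * g x ∂haarAddCircle

/-- Trilinear integral `∫ f g h`. -/
def inn3 (f g h : Torus → ℝ) : ℝ := ∫ x : Torus, f x * g x * h x ∂haarAddCircle

/-- Quadrilinear integral `∫ f g h k`. -/
def inn4 (f g h k : Torus → ℝ) : ℝ :=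
  ∫ x : Torus, f x * g x * h x * k x ∂haarAddCircle


lemma abs_cube_mul_abs_add_le (a b : ℝ) :
    |(a ^ 3 * |a| + b ^ 3 * |b|)| ≤ 4 * (|a| + |b|) ^ 3 * |a + b| := by
  have key : ∀ x y : ℝ, 0 ≤ x → 0 ≤ y → |x ^ 4 - y ^ 4| ≤ 4 * (x + y) ^ 3 * |x - y| := by
    intro x y hx hy
    have h : x ^ 4 - y ^ 4 = ((x + y) * (x ^ 2 + y ^ 2)) * (x - y) := by ring
    rw [h, abs_mul, abs_of_nonneg (by positivity)]
    refine mul_le_mul_of_nonneg_right ?_ (abs_nonneg _)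
    nlinarith [mul_nonneg (mul_nonneg hx hy) hx, mul_nonneg (mul_nonneg hx hy) hy,
      pow_nonneg hx 3, pow_nonneg hy 3]
  have key' : ∀ x y : ℝ, 0 ≤ x → 0 ≤ y → x ^ 4 + y ^ 4 ≤ 4 * (x + y) ^ 3 * (x + y) := by
    intro x y hx hy
    have h : x ^ 4 + y ^ 4 ≤ (x + y) ^ 4 := by
      have : 0 ≤ 4 * x ^ 3 * y + 6 * x ^ 2 * y ^ 2 + 4 * x * y ^ 3 := by positivity
      nlinarith
    nlinarith [pow_nonneg (add_nonneg hx hy) 4]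
  rcases le_total 0 a with ha | ha <;> rcases le_total 0 b with hb | hb
  · rw [abs_of_nonneg ha, abs_of_nonneg hb, abs_of_nonneg (by positivity),
      abs_of_nonneg (by positivity)]
    convert key' a b ha hb using 1
    ring
  · rw [abs_of_nonneg ha, abs_of_nonpos hb]
    convert key a (-b) ha (by linarith) using 2 <;> ring_nf
  · rw [abs_of_nonpos ha, abs_of_nonneg hb, ← abs_neg, ← abs_neg (a + b)]
    convert key (-a) b (by linarith) hb using 2 <;> ring_nf
  · rw [abs_of_nonpos ha, abs_of_nonpos hb, ← abs_neg, ← abs_neg (a + b)]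
    convert key' (-a) (-b) (by linarith) (by linarith) using 1
    · rw [abs_of_nonneg]
      · ring
      · have : -(a ^ 3 * -a + b ^ 3 * -b) = a ^ 4 + b ^ 4 := by ring
        rw [this]; positivity
    · rw [abs_of_nonneg (by linarith)]; ring

lemma abs_symm_symbol_le (c d : ℝ) (hc : 1 ≤ |c|) (hd : 1 ≤ |d|) :
    |c ^ 3 * |c| + d ^ 3 * |d| - 2 * (c + d) * (|c| + |d|) * (|c| * |d|)| ≤
      4 * |c + d| ^ 3 * (|c| * |d|) := by
  have same : ∀ x y : ℝ, 1 ≤ x → 1 ≤ y →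
      |x ^ 4 + y ^ 4 - 2 * (x + y) * (x + y) * (x * y)| ≤ 4 * (x + y) ^ 3 * (x * y) := by
    intro x y hx hy
    have hxy : x + y ≤ 2 * (x * y) := by nlinarith
    have h3 : (x + y) ^ 3 * (x + y) ≤ (x + y) ^ 3 * (2 * (x * y)) := by gcongr
    have h2 : (x + y) ^ 2 * (x * y) * 1 ≤ (x + y) ^ 2 * (x * y) * (x + y) := by
      gcongr; linarith
    have hp : 0 ≤ 4 * x ^ 3 * y + 6 * x ^ 2 * y ^ 2 + 4 * x * y ^ 3 := by positivity
    have hq : 0 ≤ x ^ 4 + y ^ 4 := by positivity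
    have hr : 0 ≤ (x + y) ^ 2 * (x * y) := by positivity
    rw [abs_le]
    constructor <;> nlinarith
  have opp : ∀ x y : ℝ, 1 ≤ x → 1 ≤ y →
      |x ^ 4 - y ^ 4 - 2 * (x - y) * (x + y) * (x * y)| ≤ 4 * |x - y| ^ 3 * (x * y) := by
    intro x y hx hy
    have h : x ^ 4 - y ^ 4 - 2 * (x - y) * (x + y) * (x * y) = (x - y) ^ 3 * (x + y) := by ring
    have hxy : x + y ≤ 4 * (x * y) := by nlinarith
    rw [h, abs_mul, abs_pow, abs_of_nonneg (by linarith : 0 ≤ x + y)]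
    calc |x - y| ^ 3 * (x + y) ≤ |x - y| ^ 3 * (4 * (x * y)) := by gcongr
      _ = _ := by ring
  rcases le_total 0 c with h1 | h1 <;> rcases le_total 0 d with h2 | h2
  · rw [abs_of_nonneg h1] at *
    rw [abs_of_nonneg h2] at *
    rw [abs_of_nonneg (by linarith : 0 ≤ c + d)]
    convert same c d hc hd using 2
    ring
  · rw [abs_of_nonneg h1] at *
    rw [abs_of_nonpos h2] at *
    convert opp c (-d) hc hd using 2 <;> ring_nf
  · rw [abs_of_nonpos h1] at *
    rw [abs_of_nonneg h2] at *
    convert opp d (-c) hd hc using 2 <;> ring_nf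
  · rw [abs_of_nonpos h1] at *
    rw [abs_of_nonpos h2] at *
    rw [abs_of_nonpos (by linarith : c + d ≤ 0), ← abs_neg]
    convert same (-c) (-d) hc hd using 2 <;> ring

/-- The symmetrized symbol, on the resonant hyperplane `a + b + c + d = 0`. -/
lemma abs_resonant_symbol_le (a b c d : ℝ) (h : a + b + c + d = 0) (hc : 1 ≤ |c|) (hd : 1 ≤ |d|) :
    |(|c|⁻¹ * |d|⁻¹ * (a ^ 3 * |a| + b ^ 3 * |b| + c ^ 3 * |c| + d ^ 3 * |d|) +
      2 * (a + b) * (|c| + |d|))| ≤ 12 * ((1 + |a|) ^ 3 * (1 + |b|) ^ 3) := by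
  have hcd : 0 < |c| * |d| := by positivity
  have hk : a + b = -(c + d) := by linarith
  have hle : |a + b| ≤ 2 * (|c| * |d|) := by
    rw [hk, abs_neg]
    have := abs_add_le c d
    nlinarith
  have h1 := abs_cube_mul_abs_add_le a b
  have h2 := abs_symm_symbol_le c d hc hd
  have e : |c|⁻¹ * |d|⁻¹ * (a ^ 3 * |a| + b ^ 3 * |b| + c ^ 3 * |c| + d ^ 3 * |d|) +
      2 * (a + b) * (|c| + |d|) = ((a ^ 3 * |a| + b ^ 3 * |b|) +
      (c ^ 3 * |c| + d ^ 3 * |d| - 2 * (c + d) * (|c| + |d|) * (|c| * |d|))) / (|c| * |d|) := by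
    rw [hk]
    have : |c| ≠ 0 := by positivity
    have : |d| ≠ 0 := by positivity
    field_simp
    ring
  rw [e, abs_div, abs_of_pos hcd, div_le_iff₀ hcd]
  have hab : |a| + |b| ≤ (1 + |a|) * (1 + |b|) := by nlinarith [abs_nonneg a, abs_nonneg b]
  have hcube : (|a| + |b|) ^ 3 ≤ (1 + |a|) ^ 3 * (1 + |b|) ^ 3 := by
    rw [← mul_pow]; gcongr
  have hk3 : |c + d| ^ 3 ≤ (|a| + |b|) ^ 3 := by
    have : |c + d| = |a + b| := by rw [hk, abs_neg]
    rw [this]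
    gcongr
    exact abs_add_le a b
  calc _ ≤ 4 * (|a| + |b|) ^ 3 * |a + b| + 4 * |c + d| ^ 3 * (|c| * |d|) :=
        (abs_add_le _ _).trans (add_le_add h1 h2)
    _ ≤ 4 * ((1 + |a|) ^ 3 * (1 + |b|) ^ 3) * (2 * (|c| * |d|)) +
        4 * ((1 + |a|) ^ 3 * (1 + |b|) ^ 3) * (|c| * |d|) := by
        gcongr
        exact hk3.trans hcube
    _ = _ := by ring

lemma abs_low_symbol_le (a b c d : ℝ) (h : a + b + c + d = 0) (hcd : |c| ≤ 1 ∨ |d| ≤ 1) :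
    |2 * (a + b) * (|c| + |d|)| ≤ 12 * ((1 + |a|) ^ 3 * (1 + |b|) ^ 3) := by
  have hs : |c| + |d| ≤ 2 + (|a| + |b|) := by
    rcases hcd with hc | hd
    · have e : d = -(a + b + c) := by linarith
      have := abs_add_three a b c
      rw [e, abs_neg]; linarith
    · have e : c = -(a + b + d) := by linarith
      have := abs_add_three a b d
      rw [e, abs_neg]; linarith
  have ha := abs_nonneg a
  have hb := abs_nonneg b
  have hab := abs_add_le a b
  set Q := (1 + |a|) * (1 + |b|) with hQ
  have hq : 1 + (|a| + |b|) ≤ Q := by nlinarith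
  have hQ1 : 1 ≤ Q := by linarith
  rw [← mul_pow, ← hQ, abs_mul, abs_mul, abs_two, abs_of_nonneg (by positivity : 0 ≤ |c| + |d|)]
  calc 2 * |a + b| * (|c| + |d|) ≤ 2 * Q * (2 * Q) := by
        gcongr <;> linarith
    _ ≤ 12 * Q ^ 3 := by nlinarith [sq_nonneg Q, mul_nonneg (sq_nonneg Q) (by linarith : 0 ≤ Q - 1)]

lemma integrable_of_continuous_torus {f : Torus → ℂ} (hf : Continuous f) :
    Integrable f haarAddCircle :=
  hf.integrable_of_hasCompactSupport (HasCompactSupport.of_compactSpace f)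

lemma integral_fourier_mul (k : Torus → ℝ) (n : ℤ) :
    ∫ x : Torus, fourier n x * (k x : ℂ) ∂haarAddCircle = FC k (-n) := by
  simp [FC, fourierCoeff]

/-- Parseval-type expansion of the quadrilinear integral. -/
lemma hasSum_inn4 {f g h k : Torus → ℝ} (cf : Continuous f) (cg : Continuous g)
    (ch : Continuous h) (ck : Continuous k) (sf : Summable fun n => ‖FC f n‖)
    (sg : Summable fun n => ‖FC g n‖) (sh : Summable fun n => ‖FC h n‖) :
    HasSum (fun p : (ℤ × ℤ) × ℤ => FC f p.1.1 * FC g p.1.2 * FC h p.2 *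
      FC k (-(p.1.1 + p.1.2 + p.2))) ((inn4 f g h k : ℝ) : ℂ) := by
  have series : ∀ {q : Torus → ℝ}, Continuous q → Summable (fun n => ‖FC q n‖) →
      ∀ x, HasSum (fun n => FC q n * fourier n x) (q x : ℂ) := by
    intro q cq sq x
    have := has_pointwise_sum_fourier_series_of_summable
      (f := ⟨fun x => (q x : ℂ), by fun_prop⟩) (Summable.of_norm sq) x
    exact this
  have hnorm : ∀ (n : ℤ) (x : Torus), ‖fourier n x‖ = 1 := fun n x => by
    simp only [fourier_apply, Circle.norm_coe]
  have sfg := sf.mul_of_nonneg sg (fun _ => norm_nonneg _) (fun _ => norm_nonneg _)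
  have sfgh := sfg.mul_of_nonneg sh (fun _ => by positivity) (fun _ => norm_nonneg _)
  have pointwise : ∀ x : Torus, HasSum (fun p : (ℤ × ℤ) × ℤ => FC f p.1.1 * FC g p.1.2 * FC h p.2 *
      (fourier (p.1.1 + p.1.2 + p.2) x * (k x : ℂ))) ((f x * g x * h x * k x : ℝ) : ℂ) := by
    intro x
    have h1 := (series cf sf x).mul (series cg sg x) (Summable.of_norm (by
      simpa only [norm_mul, hnorm, mul_one] using sfg))
    have h2 := h1.mul (series ch sh x) (Summable.of_norm (by
      simpa only [norm_mul, hnorm, mul_one] using sfgh))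
    have h3 := h2.mul_right (k x : ℂ)
    push_cast
    refine h3.congr_fun ?_
    intro p
    simp only [fourier_add]
    ring
  have ck' : Continuous fun x => (k x : ℂ) := by fun_prop
  have hint : ∀ p : (ℤ × ℤ) × ℤ, Integrable (fun x : Torus => FC f p.1.1 * FC g p.1.2 * FC h p.2 *
      (fourier (p.1.1 + p.1.2 + p.2) x * (k x : ℂ))) haarAddCircle := fun p =>
    integrable_of_continuous_torus (by fun_prop)
  have := hasSum_integral_of_summable_integral_norm hint (by
    simp only [norm_mul, hnorm, one_mul, integral_const_mul]
    exact sfgh.mul_right _)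
  simp only [integral_const_mul, integral_fourier_mul, (pointwise _).tsum_eq] at this
  have e : ∫ x : Torus, ((f x * g x * h x * k x : ℝ) : ℂ) ∂haarAddCircle =
      ((inn4 f g h k : ℝ) : ℂ) := integral_ofReal
  rwa [e] at this

lemma summable_weight_mul_FC (k : ℕ) (s : ℝ) (hs : 2 * k + 1 < 2 * s) :
    ∃ C : ℝ, 0 ≤ C ∧ ∀ f : Torus → ℝ, MemHs s f →
      Summable (fun n : ℤ => (1 + |(n : ℝ)|) ^ k * ‖FC f n‖) ∧
      ∑' n : ℤ, (1 + |(n : ℝ)|) ^ k * ‖FC f n‖ ≤ C * HsNorm s f := by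
  have hw : ∀ n : ℤ, (0 : ℝ) < 1 + (n : ℝ) ^ 2 := fun n => by positivity
  have hsum : Summable fun n : ℤ => ((1 + |(n : ℝ)|) ^ k * (1 + (n : ℝ) ^ 2) ^ (-(s / 2))) ^ (2 : ℝ) := by
    have hb := (Real.summable_abs_int_rpow (b := 2 * s - 2 * k) (by linarith)).mul_left (2 ^ k)
    refine Summable.of_norm_bounded_eventually hb ?_
    filter_upwards [(Set.finite_singleton (0 : ℤ)).compl_mem_cofinite] with n hn
    have hn' : 0 < |(n : ℝ)| := by simpa using hn
    rw [Real.norm_of_nonneg (by positivity), Real.rpow_two, mul_pow, ← Real.rpow_natCast _ 2,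
      ← Real.rpow_natCast ((1 + (n : ℝ) ^ 2) ^ _) 2, ← Real.rpow_mul (hw n).le, Real.rpow_natCast]
    have e1 : ((1 + |(n : ℝ)|) ^ k) ^ 2 ≤ 2 ^ k * (1 + (n : ℝ) ^ 2) ^ (k : ℝ) := by
      rw [Real.rpow_natCast, ← mul_pow, ← pow_mul, mul_comm k 2, pow_mul]
      gcongr
      nlinarith [sq_nonneg (1 - |(n : ℝ)|), sq_abs (n : ℝ)]
    calc ((1 + |(n : ℝ)|) ^ k) ^ 2 * (1 + (n : ℝ) ^ 2) ^ (-(s / 2) * (2 : ℕ))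
        ≤ 2 ^ k * (1 + (n : ℝ) ^ 2) ^ (k : ℝ) * (1 + (n : ℝ) ^ 2) ^ (-(s / 2) * (2 : ℕ)) := by
          gcongr
      _ = 2 ^ k * (1 + (n : ℝ) ^ 2) ^ ((k : ℝ) - s) := by
          rw [mul_assoc, ← Real.rpow_add (hw n)]
          congr 2
          push_cast
          ring
      _ ≤ 2 ^ k * ((n : ℝ) ^ 2) ^ ((k : ℝ) - s) := by
          refine mul_le_mul_of_nonneg_left ?_ (by positivity)
          exact Real.rpow_le_rpow_of_nonpos (by rw [← sq_abs]; positivity) (by linarith) (by linarith)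
      _ = 2 ^ k * |(n : ℝ)| ^ (-(2 * s - 2 * k)) := by
          rw [← sq_abs, ← Real.rpow_natCast _ 2, ← Real.rpow_mul hn'.le]
          congr 2
          push_cast
          ring
  refine ⟨(∑' n : ℤ, ((1 + |(n : ℝ)|) ^ k * (1 + (n : ℝ) ^ 2) ^ (-(s / 2))) ^ (2 : ℝ)) ^ (1 / 2 : ℝ),
    by positivity, fun f hf => ?_⟩
  have e2 : ∀ n : ℤ, ((1 + (n : ℝ) ^ 2) ^ (s / 2) * ‖FC f n‖) ^ (2 : ℝ) =
      (1 + (n : ℝ) ^ 2) ^ s * ‖FC f n‖ ^ 2 := by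
    intro n
    rw [Real.rpow_two, mul_pow, ← Real.rpow_natCast ((1 + (n : ℝ) ^ 2) ^ _) 2,
      ← Real.rpow_mul (hw n).le]
    norm_num
  have hCS := Real.summable_and_inner_le_Lp_mul_Lq_tsum_of_nonneg Real.HolderConjugate.two_two
    (f := fun n : ℤ => (1 + |(n : ℝ)|) ^ k * (1 + (n : ℝ) ^ 2) ^ (-(s / 2)))
    (g := fun n : ℤ => (1 + (n : ℝ) ^ 2) ^ (s / 2) * ‖FC f n‖)
    (fun n => by positivity) (fun n => by positivity) hsum (by simp only [e2]; exact hf)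
  have e3 : ∀ n : ℤ, (1 + |(n : ℝ)|) ^ k * (1 + (n : ℝ) ^ 2) ^ (-(s / 2)) *
      ((1 + (n : ℝ) ^ 2) ^ (s / 2) * ‖FC f n‖) = (1 + |(n : ℝ)|) ^ k * ‖FC f n‖ := by
    intro n
    have : (1 + (n : ℝ) ^ 2) ^ (-(s / 2)) * (1 + (n : ℝ) ^ 2) ^ (s / 2) = 1 := by
      rw [← Real.rpow_add (hw n)]; simp
    linear_combination ((1 + |(n : ℝ)|) ^ k * ‖FC f n‖) * this
  simp only [e3, e2] at hCS
  refine ⟨hCS.1, hCS.2.trans_eq ?_⟩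
  rw [HsNorm, Real.sqrt_eq_rpow]

lemma HsNorm_zero_sq (f : Torus → ℝ) : HsNorm 0 f ^ 2 = ∑' n : ℤ, ‖FC f n‖ ^ 2 := by
  rw [HsNorm, Real.sq_sqrt (tsum_nonneg fun n => by positivity)]
  simp

lemma MemHs.mono {s t : ℝ} (hst : s ≤ t) {f : Torus → ℝ} (hf : MemHs t f) : MemHs s f := by
  refine Summable.of_nonneg_of_le (fun n => by positivity) (fun n => ?_) hf
  gcongr
  nlinarith [sq_nonneg (n : ℝ)]

/-- Young-type convolution bound on the resonant set. -/
lemma norm_le_of_hasSum_resonant {F : (ℤ × ℤ) × ℤ → ℂ} {S : ℂ} (hF : HasSum F S)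
    {U W : ℤ → ℝ} (hU : ∀ n, 0 ≤ U n) (sU : Summable U)
    (sW : Summable fun n => W n ^ 2) {K : ℝ} (hK : 0 ≤ K)
    (hb : ∀ a b c, ‖F ((a, b), c)‖ ≤ K * (U a * U b * (W c * W (-(a + b + c))))) :
    ‖S‖ ≤ K * ((∑' n, U n) ^ 2 * ∑' n, W n ^ 2) := by
  have sUU := sU.mul_of_nonneg sU hU hU
  have h2 := sU.hasSum.mul sU.hasSum sUU
  have h3s := sUU.mul_of_nonneg sW (fun p => mul_nonneg (hU _) (hU _)) (fun n => sq_nonneg _)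
  have h3 := h2.mul sW.hasSum h3s
  let e : (ℤ × ℤ) × ℤ ≃ (ℤ × ℤ) × ℤ :=
    { toFun := fun p => (p.1, -(p.1.1 + p.1.2 + p.2))
      invFun := fun p => (p.1, -(p.1.1 + p.1.2 + p.2))
      left_inv := fun p => Prod.ext rfl (by ring)
      right_inv := fun p => Prod.ext rfl (by ring) }
  have h4 := (e.hasSum_iff).2 h3
  have h5 := (h3.add h4).mul_left (K / 2)
  refine (hF.norm_le_of_bounded h5 ?_).trans_eq (by ring)
  rintro ⟨⟨a, b⟩, c⟩
  refine (hb a b c).trans ?_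
  simp only [Function.comp, e, Equiv.coe_fn_mk]
  have : W c * W (-(a + b + c)) ≤ (W c ^ 2 + W (-(a + b + c)) ^ 2) / 2 := by
    nlinarith [sq_nonneg (W c - W (-(a + b + c)))]
  have h6 := mul_le_mul_of_nonneg_left this (mul_nonneg hK (mul_nonneg (hU a) (hU b)))
  linarith

lemma symH_mul_symDx (n : ℤ) : symH n * symDx n = ((|(n : ℝ)| : ℝ) : ℂ) := by
  have h : ((Int.sign n : ℤ) : ℂ) * (n : ℂ) = ((|(n : ℝ)| : ℝ) : ℂ) := by
    rw [← Int.cast_abs, ← Int.sign_mul_self_eq_abs]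
    push_cast
    rfl
  rw [symH, symDx, ← h]
  linear_combination (-(Int.sign n : ℂ) * n) * Complex.I_mul_I

lemma symH_mul_symDx_pow_four (n : ℤ) :
    symH n * symDx n ^ 4 = -Complex.I * (((n : ℝ) ^ 3 * |(n : ℝ)| : ℝ) : ℂ) := by
  have h : symH n * symDx n ^ 4 = symH n * symDx n * symDx n ^ 3 := by ring
  rw [h, symH_mul_symDx, symDx, mul_pow, Complex.I_pow_three]
  push_cast
  ring

lemma symJ_eq_zero {ψ : ℝ → ℝ} (hψ : IsCutoff ψ) {n : ℤ} (hn : |(n : ℝ)| ≤ 1) : symJ ψ n = 0 := by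
  simp [symJ, hψ.2.2.2.2 _ hn]

lemma symJ_eq_inv {ψ : ℝ → ℝ} (hψ : IsCutoff ψ) {n : ℤ} (hn : 1 < |(n : ℝ)|) :
    symJ ψ n = ((|(n : ℝ)|⁻¹ : ℝ) : ℂ) := by
  have h2 : (2 : ℝ) ≤ |(n : ℝ)| := by
    rw [← Int.cast_abs] at hn ⊢
    have : (1 : ℤ) < |n| := by exact_mod_cast hn
    exact_mod_cast this
  simp [symJ, hψ.2.2.2.1 _ h2]

lemma norm_symJ_le {ψ : ℝ → ℝ} (hψ : IsCutoff ψ) (n : ℤ) : ‖symJ ψ n‖ ≤ 1 := by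
  rcases le_or_gt |(n : ℝ)| 1 with hn | hn
  · simp [symJ_eq_zero hψ hn]
  · rw [symJ_eq_inv hψ hn, Complex.norm_real, norm_inv, Real.norm_eq_abs, abs_abs]
    exact inv_le_one_of_one_le₀ hn.le

lemma norm_symmetrized_symbol_le {ψ : ℝ → ℝ} (hψ : IsCutoff ψ) (a b c d : ℤ)
    (h : a + b + c + d = 0) :
    ‖symJ ψ c * symJ ψ d * (symH a * symDx a ^ 4 + symH b * symDx b ^ 4 + symH c * symDx c ^ 4 +
        symH d * symDx d ^ 4) - 2 * (symDx a + symDx b) * (symH c * symDx c + symH d * symDx d)‖ ≤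
      12 * ((1 + |(a : ℝ)|) ^ 3 * (1 + |(b : ℝ)|) ^ 3) := by
  have hr : (a : ℝ) + b + c + d = 0 := by exact_mod_cast h
  simp only [symH_mul_symDx_pow_four, symH_mul_symDx]
  have fin : ∀ (z : ℂ) (r : ℝ), z = -Complex.I * (r : ℂ) → ‖z‖ = |r| := by
    rintro z r rfl
    simp
  by_cases hcd : 1 < |(c : ℝ)| ∧ 1 < |(d : ℝ)|
  · rw [symJ_eq_inv hψ hcd.1, symJ_eq_inv hψ hcd.2]
    refine (fin _ _ ?_).trans_le (abs_resonant_symbol_le a b c d hr hcd.1.le hcd.2.le)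
    simp only [symDx]
    push_cast
    ring
  · have hcd' : |(c : ℝ)| ≤ 1 ∨ |(d : ℝ)| ≤ 1 := by
      simpa only [not_and_or, not_lt] using hcd
    have h0 : symJ ψ c * symJ ψ d = 0 := by
      rcases hcd' with hc | hd
      · rw [symJ_eq_zero hψ hc, zero_mul]
      · rw [symJ_eq_zero hψ hd, mul_zero]
    rw [h0]
    refine (fin _ _ ?_).trans_le (abs_low_symbol_le a b c d hr hcd')
    simp only [symDx]
    push_cast
    ring

lemma norm_symH_le (n : ℤ) : ‖symH n‖ ≤ 1 := by
  rcases lt_trichotomy n 0 with h | h | h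
  · simp [symH, Int.sign_eq_neg_one_of_neg h]
  · simp [symH, h]
  · simp [symH, Int.sign_eq_one_of_pos h]

lemma norm_symDx (n : ℤ) : ‖symDx n‖ = |(n : ℝ)| := by
  simp [symDx]

lemma HasSymbol.summable {m : ℤ → ℂ} {f g : Torus → ℝ} (h : HasSymbol m f g) {k : ℕ}
    (hm : ∀ n : ℤ, ‖m n‖ ≤ (1 + |(n : ℝ)|) ^ k)
    (hf : Summable fun n : ℤ => (1 + |(n : ℝ)|) ^ k * ‖FC f n‖) :
    Summable fun n => ‖FC g n‖ := by
  refine Summable.of_nonneg_of_le (fun n => norm_nonneg _) (fun n => ?_) hf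
  rw [h n, norm_mul]
  gcongr
  exact hm n

/-- `|⟨uH∂ₓ⁴u, (Jw)²⟩ + ⟨u²Jw, HJ∂ₓ⁴w⟩ − 4⟨u∂ₓu·H∂ₓw, w⟩|
≤ C‖u‖_{H^{s₀}}²‖w‖_{L²}²`. -/
theorem statement19 (s₀ : ℝ) (hs₀ : 7 / 2 < s₀) (ψ : ℝ → ℝ) (hψ : IsCutoff ψ) :
    ∃ C > (0 : ℝ), ∀ u w u1 Hu4 Jw HJw4 Hw1 : Torus → ℝ,
      Continuous u → MemHs (s₀ + 1) u →
      Continuous w → MemHs (s₀ + 1) w →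
      Continuous u1 → HasSymbol symDx u u1 →
      Continuous Hu4 → HasSymbol (fun n => symH n * symDx n ^ 4) u Hu4 →
      Continuous Jw → HasSymbol (symJ ψ) w Jw →
      Continuous HJw4 → HasSymbol (fun n => symH n * symJ ψ n * symDx n ^ 4) w HJw4 →
      Continuous Hw1 → HasSymbol (fun n => symH n * symDx n) w Hw1 →
      |inn4 u Hu4 Jw Jw + inn4 u u Jw HJw4 - 4 * inn4 u u1 Hw1 w| ≤
        C * HsNorm s₀ u ^ 2 * HsNorm 0 w ^ 2 := by
  obtain ⟨C, hC, hCu⟩ := summable_weight_mul_FC 3 s₀ (by push_cast; linarith)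
  obtain ⟨_, -, hS⟩ := summable_weight_mul_FC 4 (s₀ + 1) (by push_cast; linarith)
  refine ⟨6 * C ^ 2 + 1, by positivity, ?_⟩
  intro u w u1 Hu4 Jw HJw4 Hw1 cu mu cw mw cu1 eu1 cHu4 eHu4 cJw eJw cHJ eHJ cHw eHw
  obtain ⟨su3, hu3⟩ := hCu u (mu.mono (by linarith))
  have su4 := (hS u mu).1
  have sw4 := (hS w mw).1
  have one_le : ∀ n : ℤ, 1 ≤ 1 + |(n : ℝ)| := fun n => by simp
  have le_four : ∀ n : ℤ, 1 + |(n : ℝ)| ≤ (1 + |(n : ℝ)|) ^ 4 := fun n =>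
    le_self_pow₀ (one_le n) (by norm_num)
  have hDx4 : ∀ n : ℤ, ‖symDx n ^ 4‖ ≤ (1 + |(n : ℝ)|) ^ 4 := fun n => by
    rw [norm_pow, norm_symDx]
    gcongr
    linarith
  have hHDx4 : ∀ n : ℤ, ‖symH n * symDx n ^ 4‖ ≤ (1 + |(n : ℝ)|) ^ 4 := fun n => by
    rw [norm_mul]
    exact (mul_le_of_le_one_left (norm_nonneg _) (norm_symH_le n)).trans (hDx4 n)
  have hHDx : ∀ n : ℤ, ‖symH n * symDx n‖ ≤ (1 + |(n : ℝ)|) ^ 4 := fun n => by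
    rw [symH_mul_symDx, Complex.norm_real, Real.norm_eq_abs, abs_abs]
    linarith [le_four n]
  have id_symbol : ∀ f : Torus → ℝ, HasSymbol (fun _ => 1) f f := fun f n => by simp
  have one_le_four : ∀ n : ℤ, ‖(1 : ℂ)‖ ≤ (1 + |(n : ℝ)|) ^ 4 := fun n => by
    rw [norm_one]
    exact (one_le n).trans (le_four n)
  have su := (id_symbol u).summable one_le_four su4
  have sw := (id_symbol w).summable one_le_four sw4
  have su1 := eu1.summable (fun n => by rw [norm_symDx]; linarith [le_four n]) su4
  have sHu4 := eHu4.summable hHDx4 su4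
  have sJw := eJw.summable (fun n => (norm_symJ_le hψ n).trans ((one_le n).trans (le_four n))) sw4
  have sHJ := eHJ.summable (fun n => by
    rw [mul_right_comm, norm_mul]
    exact (mul_le_of_le_one_right (norm_nonneg _) (norm_symJ_le hψ n)).trans (hHDx4 n)) sw4
  have sHw := eHw.summable hHDx sw4
  have t1 := hasSum_inn4 cu cHu4 cJw cJw su sHu4 sJw
  have t2 := hasSum_inn4 cHu4 cu cJw cJw sHu4 su sJw
  have t3 := hasSum_inn4 cu cu cJw cHJ su su sJw
  have t4 := hasSum_inn4 cu cu cHJ cJw su su sHJ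
  have t5 := hasSum_inn4 cu cu1 cHw cw su su1 sHw
  have t6 := hasSum_inn4 cu1 cu cHw cw su1 su sHw
  have t7 := hasSum_inn4 cu cu1 cw cHw su su1 sw
  have t8 := hasSum_inn4 cu1 cu cw cHw su1 su sw
  have i2 : inn4 Hu4 u Jw Jw = inn4 u Hu4 Jw Jw := integral_congr_ae (.of_forall fun x => by ring)
  have i4 : inn4 u u HJw4 Jw = inn4 u u Jw HJw4 := integral_congr_ae (.of_forall fun x => by ring)
  have i6 : inn4 u1 u Hw1 w = inn4 u u1 Hw1 w := integral_congr_ae (.of_forall fun x => by ring)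
  have i7 : inn4 u u1 w Hw1 = inn4 u u1 Hw1 w := integral_congr_ae (.of_forall fun x => by ring)
  have i8 : inn4 u1 u w Hw1 = inn4 u u1 Hw1 w := integral_congr_ae (.of_forall fun x => by ring)
  rw [i2] at t2
  rw [i4] at t4
  rw [i6] at t6
  rw [i7] at t7
  rw [i8] at t8
  have total := (((t1.add t2).add t3).add t4).sub
    ((((t5.add t6).add t7).add t8).mul_left 2)
  have sw2 : Summable fun n : ℤ => ‖FC w n‖ ^ 2 := by
    have := mw.mono (show (0 : ℝ) ≤ s₀ + 1 by linarith)
    simpa [MemHs] using this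
  have bound := norm_le_of_hasSum_resonant total (U := fun n => (1 + |(n : ℝ)|) ^ 3 * ‖FC u n‖)
    (W := fun n => ‖FC w n‖) (fun n => by positivity) su3 sw2 (K := 12) (by norm_num) (by
      intro a b c
      have hM := norm_symmetrized_symbol_le hψ a b c (-(a + b + c)) (by ring)
      simp only [eu1 _, eHu4 _, eJw _, eHJ _, eHw _]
      generalize -(a + b + c) = d at hM ⊢
      calc _ = ‖(symJ ψ c * symJ ψ d * (symH a * symDx a ^ 4 + symH b * symDx b ^ 4 +
              symH c * symDx c ^ 4 + symH d * symDx d ^ 4) -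
              2 * (symDx a + symDx b) * (symH c * symDx c + symH d * symDx d)) *
              (FC u a * FC u b * (FC w c * FC w d))‖ := by
            congr 1
            ring
        _ ≤ 12 * ((1 + |(a : ℝ)|) ^ 3 * (1 + |(b : ℝ)|) ^ 3) *
              (‖FC u a‖ * ‖FC u b‖ * (‖FC w c‖ * ‖FC w d‖)) := by
            rw [norm_mul]
            simp only [norm_mul (FC u a * FC u b), norm_mul (FC u a), norm_mul (FC w c)]
            gcongr
        _ = _ := by ring)
  rw [← HsNorm_zero_sq] at bound
  have hU : (∑' n : ℤ, (1 + |(n : ℝ)|) ^ 3 * ‖FC u n‖) ^ 2 ≤ (C * HsNorm s₀ u) ^ 2 := by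
    gcongr
  have hnorm : ∀ (z : ℂ) (r : ℝ), z = ((2 * r : ℝ) : ℂ) → ‖z‖ = 2 * |r| := by
    rintro z r rfl
    rw [Complex.norm_real, Real.norm_eq_abs, abs_mul, abs_two]
  rw [hnorm _ (inn4 u Hu4 Jw Jw + inn4 u u Jw HJw4 - 4 * inn4 u u1 Hw1 w)
    (by push_cast; ring)] at bound
  have h1 := mul_le_mul_of_nonneg_right hU (sq_nonneg (HsNorm 0 w))
  have h2 : 0 ≤ HsNorm s₀ u ^ 2 * HsNorm 0 w ^ 2 := by positivity
  nlinarith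

end
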